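/- arXiv:2110.13615 — 4 statements merged into one kernel-verified Lean document; each statement's English description precedes it below -/
import Mathlib

section
/- The triangle T1 with vertices V1, V2, V3 is a solution of the Cramer–Castillon problem for the triangle ABC and its incircle: V1, V2 and V3 all lie on the incircle (dist(I,V1) = dist(I,V2) = dist(I,V3) = r), and the sides pass cyclically through the vertices of ABC, namely A lies on the line through V1 and V2, B lies on the line through V2 and V3, and C lies on the line through V3 and V1. -/
open EuclideanGeometry

/-- The point with barycentric coordinates `[x : y : z]` with respect to `(A, B, C)`. -/
noncomputable def bary (A B C : EuclideanSpace ℝ (Fin 2)) (x y z : ℝ) :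
    EuclideanSpace ℝ (Fin 2) :=
  (x + y + z)⁻¹ • (x • A + y • B + z • C)

section Incircle

variable {V : Type*} [NormedAddCommGroup V] [InnerProductSpace ℝ V]
  {A B C : EuclideanSpace ℝ (Fin 2)} {u v w x y z : ℝ}

theorem dist_lt_dist_add_dist_of_not_collinear {X Y Z : V} (h : ¬ Collinear ℝ {X, Y, Z}) :
    dist X Z < dist X Y + dist Y Z :=
  (dist_triangle X Y Z).lt_of_ne fun he => h (dist_add_dist_eq_iff.1 he.symm).collinear

theorem bary_sub (h : x + y + z ≠ 0) (I : EuclideanSpace ℝ (Fin 2)) :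
    bary A B C x y z - I = (x + y + z)⁻¹ • (x • (A - I) + y • (B - I) + z • (C - I)) := by
  have hI : I = (x + y + z)⁻¹ • ((x + y + z) • I) := (inv_smul_smul₀ h I).symm
  rw [bary]
  nth_rw 1 [hI]
  rw [← smul_sub]
  congr 1
  module

/-- The squared length of a combination of vectors, in terms of the squared distances between
their tips. -/
theorem norm_sq_smul_add_smul_add_smul (X Y Z : V) (x y z : ℝ) :
    ‖x • X + y • Y + z • Z‖ ^ 2 = (x + y + z) * (x * ‖X‖ ^ 2 + y * ‖Y‖ ^ 2 + z * ‖Z‖ ^ 2)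
      - y * z * ‖Y - Z‖ ^ 2 - z * x * ‖Z - X‖ ^ 2 - x * y * ‖X - Y‖ ^ 2 := by
  simp only [← real_inner_self_eq_norm_sq, inner_add_left, inner_add_right, inner_sub_left,
    inner_sub_right, real_inner_smul_left, real_inner_smul_right]
  rw [real_inner_comm X Y, real_inner_comm X Z, real_inner_comm Y Z]
  ring

/-- The squared distance from a vertex to the incenter, where the sides are `v + w`, `w + u`,
`u + v`. -/
theorem dist_sq_vertex_incenter (h : u + v + w ≠ 0)
    (ha : dist B C = v + w) (hb : dist C A = w + u) (hc : dist A B = u + v) :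
    ‖A - bary A B C (v + w) (w + u) (u + v)‖ ^ 2 = u * v * w / (u + v + w) + u ^ 2 := by
  have hS : (v + w) + (w + u) + (u + v) ≠ 0 := by
    intro h0; apply h; linarith
  rw [norm_sub_rev, bary_sub hS, norm_smul, mul_pow, norm_sq_smul_add_smul_add_smul, sub_self,
    norm_zero, sub_zero, zero_sub, norm_neg, sub_sub_sub_cancel_right,
    ← dist_eq_norm, ← dist_eq_norm, ← dist_eq_norm, dist_comm B A, ha, hb, hc,
    Real.norm_eq_abs, sq_abs]
  have hS' : (v + w) + (w + u) + (u + v) = 2 * (u + v + w) := by ring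
  rw [hS']
  field_simp
  ring

theorem bary_rotate (A B C : EuclideanSpace ℝ (Fin 2)) (x y z : ℝ) : bary B C A y z x = bary A B C x y z := by
  rw [bary, bary, show y + z + x = x + y + z by ring]
  congr 1
  abel

/-- The power of a point with respect to the incircle, in barycentric coordinates. -/
theorem norm_sq_smul_sub_incenter (h : u + v + w ≠ 0)
    (ha : dist B C = v + w) (hb : dist C A = w + u) (hc : dist A B = u + v) (x y z : ℝ) :
    ‖x • (A - bary A B C (v + w) (w + u) (u + v)) + y • (B - bary A B C (v + w) (w + u) (u + v))
      + z • (C - bary A B C (v + w) (w + u) (u + v))‖ ^ 2 =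
    u * v * w / (u + v + w) * (x + y + z) ^ 2 + (x * u) ^ 2 + (y * v) ^ 2 + (z * w) ^ 2
      - 2 * (x * u) * (y * v) - 2 * (y * v) * (z * w) - 2 * (z * w) * (x * u) := by
  have hA := dist_sq_vertex_incenter h ha hb hc
  have hB := dist_sq_vertex_incenter (by rwa [add_assoc, add_comm] at h) hb hc ha
  have hC := dist_sq_vertex_incenter (by rwa [add_comm, ← add_assoc] at h) hc ha hb
  rw [bary_rotate A B C] at hB
  rw [bary_rotate B C A, bary_rotate A B C] at hC
  rw [show v * w * u / (v + w + u) = u * v * w / (u + v + w) by ring_nf] at hB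
  rw [show w * u * v / (w + u + v) = u * v * w / (u + v + w) by ring_nf] at hC
  rw [norm_sq_smul_add_smul_add_smul, hA, hB, hC, sub_sub_sub_cancel_right,
    sub_sub_sub_cancel_right, sub_sub_sub_cancel_right, ← dist_eq_norm, ← dist_eq_norm,
    ← dist_eq_norm, ha, hb, hc]
  ring

theorem dist_incenter_bary (h : u + v + w ≠ 0)
    (ha : dist B C = v + w) (hb : dist C A = w + u) (hc : dist A B = u + v)
    (hxyz : x + y + z ≠ 0)
    (hq : (x * u) ^ 2 + (y * v) ^ 2 + (z * w) ^ 2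
      - 2 * (x * u) * (y * v) - 2 * (y * v) * (z * w) - 2 * (z * w) * (x * u) = 0) :
    dist (bary A B C (v + w) (w + u) (u + v)) (bary A B C x y z) =
      √(u * v * w / (u + v + w)) := by
  rw [← Real.sqrt_sq (dist_nonneg (x := bary A B C (v + w) (w + u) (u + v))), dist_comm,
    dist_eq_norm, bary_sub hxyz, norm_smul, mul_pow, norm_sq_smul_sub_incenter h ha hb hc,
    Real.norm_eq_abs, sq_abs]
  congr 1
  field_simp
  field_simp at hq
  linear_combination (u + v + w) * hq

theorem infDist_incenter (hu : 0 < u) (hv : 0 < v) (hw : 0 < w)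
    (ha : dist B C = v + w) (hb : dist C A = w + u) (hc : dist A B = u + v) :
    Metric.infDist (bary A B C (v + w) (w + u) (u + v)) (affineSpan ℝ {B, C} : Set (EuclideanSpace ℝ (Fin 2))) =
      √(u * v * w / (u + v + w)) := by
  have h : u + v + w ≠ 0 := by positivity
  set I := bary A B C (v + w) (w + u) (u + v) with hI
  have key (t : ℝ) : dist I (AffineMap.lineMap B C t) ^ 2 =
      u * v * w / (u + v + w) + ((1 - t) * v - t * w) ^ 2 := by
    have := norm_sq_smul_sub_incenter h ha hb hc 0 (1 - t) t
    rw [← hI] at this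
    rw [dist_comm, dist_eq_norm, AffineMap.lineMap_apply_module,
      show (1 - t) • B + t • C - I = (0 : ℝ) • (A - I) + (1 - t) • (B - I) + t • (C - I) by module,
      this]
    ring
  apply le_antisymm
  · refine (Metric.infDist_le_dist_of_mem
      (AffineMap.lineMap_mem_affineSpan_pair (v / (v + w)) B C)).trans ?_
    apply Real.le_sqrt_of_sq_le
    rw [key]
    apply le_of_eq
    field_simp
    ring
  · rw [Metric.le_infDist ⟨B, left_mem_affineSpan_pair ℝ B C⟩]
    intro Q hQ
    obtain ⟨t, rfl⟩ := mem_affineSpan_pair_iff_exists_lineMap_eq.1 hQ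
    apply Real.sqrt_le_iff.2 ⟨dist_nonneg, ?_⟩
    rw [key]
    nlinarith [sq_nonneg ((1 - t) * v - t * w)]

/-- Points whose weighted position vectors differ by a multiple of `X` span a line through `X`. -/
theorem mem_affineSpan_pair_of_smul_sub_smul {X Q R : V} {p q : ℝ} (hpq : p ≠ q)
    (h : p • Q - q • R = (p - q) • X) : X ∈ affineSpan ℝ ({Q, R} : Set V) := by
  have hne : p - q ≠ 0 := sub_ne_zero.2 hpq
  refine mem_affineSpan_pair_iff_exists_lineMap_eq.2 ⟨-q / (p - q), ?_⟩
  rw [AffineMap.lineMap_apply_module, ← inv_smul_smul₀ hne X, ← h, smul_sub, smul_smul, smul_smul]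
  match_scalars <;> field_simp <;> ring

theorem smul_bary (h : x + y + z ≠ 0) :
    (x + y + z) • bary A B C x y z = x • A + y • B + z • C := by
  rw [bary, smul_inv_smul₀ h]

end Incircle

/-- The triangle `T1 = (V1, V2, V3)` is a solution of the Cramer–Castillon problem for the
triangle `ABC` and its incircle: its vertices lie on the incircle and its sides pass
cyclically through `A`, `B`, `C`. -/
theorem ccp_incircle_first_solution
    (A B C : EuclideanSpace ℝ (Fin 2)) (hABC : AffineIndependent ℝ ![A, B, C])
    (a b c s u v w φ : ℝ)
    (ha : a = dist B C) (hb : b = dist C A) (hc : c = dist A B)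
    (hs : s = (a + b + c) / 2)
    (hu : u = s - a) (hv : v = s - b) (hw : w = s - c)
    (hφ : φ = (1 + Real.sqrt 5) / 2)
    (I : EuclideanSpace ℝ (Fin 2)) (hI : I = bary A B C a b c)
    (r : ℝ) (hr : r = Metric.infDist I (affineSpan ℝ {B, C} : Set (EuclideanSpace ℝ (Fin 2))))
    (V1 V2 V3 : EuclideanSpace ℝ (Fin 2))
    (hV1 : V1 = bary A B C (φ ^ 2 / u) (1 / v) ((φ - 1) ^ 2 / w))
    (hV2 : V2 = bary A B C ((φ - 2) ^ 2 / u) (1 / v) ((φ - 1) ^ 2 / w))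
    (hV3 : V3 = bary A B C ((φ - 2) ^ 2 / u) ((2 * φ - 3) ^ 2 / v) ((φ - 1) ^ 2 / w)) :
    dist I V1 = r ∧ dist I V2 = r ∧ dist I V3 = r ∧
    A ∈ affineSpan ℝ ({V1, V2} : Set (EuclideanSpace ℝ (Fin 2))) ∧
    B ∈ affineSpan ℝ ({V2, V3} : Set (EuclideanSpace ℝ (Fin 2))) ∧
    C ∈ affineSpan ℝ ({V3, V1} : Set (EuclideanSpace ℝ (Fin 2))) := by
  have hnc : ¬ Collinear ℝ {A, B, C} := affineIndependent_iff_not_collinear_set.1 hABC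
  have hu0 : 0 < u := by
    have := dist_lt_dist_add_dist_of_not_collinear (X := B) (Y := A) (Z := C)
      (by rwa [Set.insert_comm])
    rw [dist_comm B A, dist_comm A C] at this
    linarith
  have hv0 : 0 < v := by
    have hlt : dist A C < _ := dist_lt_dist_add_dist_of_not_collinear hnc
    rw [dist_comm A C] at hlt
    linarith
  have hw0 : 0 < w := by
    have := dist_lt_dist_add_dist_of_not_collinear (X := A) (Y := C) (Z := B)
      (by rwa [Set.pair_comm])
    rw [dist_comm A C, dist_comm C B] at this
    linarith
  have ha' : dist B C = v + w := by linarith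
  have hb' : dist C A = w + u := by linarith
  have hc' : dist A B = u + v := by linarith
  have hI' : I = bary A B C (v + w) (w + u) (u + v) := by
    rw [hI, ha, hb, hc, ha', hb', hc']
  have hr' : r = √(u * v * w / (u + v + w)) := by
    rw [hr, hI', infDist_incenter hu0 hv0 hw0 ha' hb' hc']
  have h0 : u + v + w ≠ 0 := by positivity
  have hsq : φ ^ 2 = φ + 1 := hφ ▸ Real.goldenRatio_sq
  have hφ1 : 1 < φ := hφ ▸ Real.one_lt_goldenRatio
  have hS1 : φ ^ 2 / u + 1 / v + (φ - 1) ^ 2 / w ≠ 0 := by positivity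
  have hS2 : (φ - 2) ^ 2 / u + 1 / v + (φ - 1) ^ 2 / w ≠ 0 := by positivity
  have hφ1' : 0 < φ - 1 := by linarith
  have hS3 : (φ - 2) ^ 2 / u + (2 * φ - 3) ^ 2 / v + (φ - 1) ^ 2 / w ≠ 0 := by positivity
  have hdist {x y z : ℝ} (hxyz : x / u + y / v + z / w ≠ 0)
      (hq : x ^ 2 + y ^ 2 + z ^ 2 - 2 * x * y - 2 * y * z - 2 * z * x = 0) :
      dist I (bary A B C (x / u) (y / v) (z / w)) = r := by
    rw [hr', hI']
    apply dist_incenter_bary h0 ha' hb' hc' hxyz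
    rwa [div_mul_cancel₀ _ hu0.ne', div_mul_cancel₀ _ hv0.ne', div_mul_cancel₀ _ hw0.ne']
  refine ⟨?_, ?_, ?_, ?_, ?_, ?_⟩
  · rw [hV1]
    exact hdist hS1 (by ring)
  · rw [hV2]
    exact hdist hS2 (by ring)
  · rw [hV3]
    exact hdist hS3 (by ring)
  · apply mem_affineSpan_pair_of_smul_sub_smul
      (p := φ ^ 2 / u + 1 / v + (φ - 1) ^ 2 / w) (q := (φ - 2) ^ 2 / u + 1 / v + (φ - 1) ^ 2 / w)
    · intro h
      have : φ ^ 2 / u = (φ - 2) ^ 2 / u := by linarith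
      rw [div_left_inj' hu0.ne'] at this
      linarith
    · rw [hV1, hV2, smul_bary hS1, smul_bary hS2]
      module
  · apply mem_affineSpan_pair_of_smul_sub_smul
      (p := (φ - 2) ^ 2 / u + 1 / v + (φ - 1) ^ 2 / w)
      (q := (φ - 2) ^ 2 / u + (2 * φ - 3) ^ 2 / v + (φ - 1) ^ 2 / w)
    · intro h
      have : 1 / v = (2 * φ - 3) ^ 2 / v := by linarith
      rw [div_left_inj' hv0.ne'] at this
      nlinarith
    · rw [hV2, hV3, smul_bary hS2, smul_bary hS3]
      module
  · have hk : (φ - 2) ^ 2 = (2 * φ - 3) ^ 2 * φ ^ 2 := by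
      linear_combination (-4 * φ ^ 2 + 8 * φ - 4) * hsq
    apply mem_affineSpan_pair_of_smul_sub_smul
      (p := (φ - 2) ^ 2 / u + (2 * φ - 3) ^ 2 / v + (φ - 1) ^ 2 / w)
      (q := (2 * φ - 3) ^ 2 * (φ ^ 2 / u + 1 / v + (φ - 1) ^ 2 / w))
    · intro h
      rw [hk] at h
      have : (φ - 1) ^ 2 / w * (1 - (2 * φ - 3) ^ 2) = 0 := by linear_combination h
      have h1 : (φ - 1) ^ 2 / w ≠ 0 := by positivity
      have := (mul_eq_zero.1 this).resolve_left h1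
      nlinarith
    · rw [hV1, hV3, smul_bary hS3, mul_smul, smul_bary hS1, hk]
      module
end

section
/- The Cramer–Castillon problem on the incircle has exactly two solutions: if M1, M2, M3 are pairwise distinct points on the incircle of ABC (dist(I,Mi) = r for i = 1,2,3) such that A lies on the line through M1 and M2, B lies on the line through M2 and M3, and C lies on the line through M3 and M1, then (M1,M2,M3) = (V1,V2,V3) or (M1,M2,M3) = (W1,W2,W3). -/
open EuclideanGeometry

/-- Squared length of a vector given by barycentric weights of total mass zero. -/
theorem norm_sq_of_weights_sum_zero (A B C : EuclideanSpace ℝ (Fin 2)) {x y z : ℝ}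
    (h : x + y + z = 0) :
    ‖x • A + y • B + z • C‖ ^ 2 =
      -(dist B C ^ 2 * (y * z) + dist C A ^ 2 * (z * x) + dist A B ^ 2 * (x * y)) := by
  obtain rfl : z = -x - y := by linarith
  simp only [EuclideanSpace.dist_eq, EuclideanSpace.norm_sq_eq, Fin.sum_univ_two, Real.dist_eq,
    sq_abs, Real.norm_eq_abs, PiLp.add_apply, PiLp.smul_apply, smul_eq_mul]
  rw [Real.sq_sqrt (by positivity), Real.sq_sqrt (by positivity), Real.sq_sqrt (by positivity)]
  ring

theorem dist_add_dist_gt_of_affineIndependent {A B C : EuclideanSpace ℝ (Fin 2)}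
    (h : AffineIndependent ℝ ![A, B, C]) : dist A C < dist A B + dist B C := by
  refine lt_of_le_of_ne (dist_triangle A B C) fun he => ?_
  rw [affineIndependent_iff_not_collinear_set] at h
  exact h (dist_add_dist_eq_iff.1 he.symm).collinear

/-- Barycentric coordinates with respect to a nondegenerate triangle. -/
theorem exists_weights_of_affineIndependent {A B C : EuclideanSpace ℝ (Fin 2)}
    (h : AffineIndependent ℝ ![A, B, C]) (M : EuclideanSpace ℝ (Fin 2)) :
    ∃ x y z : ℝ, x + y + z = 1 ∧ M = x • A + y • B + z • C := by
  have htop : affineSpan ℝ (Set.range ![A, B, C]) = ⊤ := by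
    rw [h.affineSpan_eq_top_iff_card_eq_finrank_add_one]
    simp
  let T : AffineBasis (Fin 3) ℝ (EuclideanSpace ℝ (Fin 2)) := ⟨![A, B, C], h, htop⟩
  refine ⟨T.coord 0 M, T.coord 1 M, T.coord 2 M, ?_, ?_⟩
  · rw [← T.sum_coord_apply_eq_one M, Fin.sum_univ_three]
  · have := T.linear_combination_coord_eq_self M
    rw [Fin.sum_univ_three] at this
    exact this.symm

theorem weights_unique_of_affineIndependent {A B C : EuclideanSpace ℝ (Fin 2)}
    (h : AffineIndependent ℝ ![A, B, C]) {x y z : ℝ} (hs : x + y + z = 0)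
    (h0 : x • A + y • B + z • C = 0) : x = 0 ∧ y = 0 ∧ z = 0 := by
  have key := (affineIndependent_iff.1 h) Finset.univ ![x, y, z]
    (by simpa [Fin.sum_univ_three] using hs) (by simpa [Fin.sum_univ_three] using h0)
  exact ⟨key 0 (by simp), key 1 (by simp), key 2 (by simp)⟩

theorem bary_eq_of_proportional (A B C : EuclideanSpace ℝ (Fin 2)) {x y z x' y' z' k : ℝ}
    (h : x + y + z = 1) (hx : x = k * x') (hy : y = k * y') (hz : z = k * z') :
    x • A + y • B + z • C = bary A B C x' y' z' := by
  have hk : k = (x' + y' + z')⁻¹ := by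
    refine eq_inv_of_mul_eq_one_left ?_
    rw [← h, hx, hy, hz]; ring
  rw [bary, ← hk, hx, hy, hz]
  simp only [smul_add, smul_smul]

/-- Squared distance from the incenter to a point, relative to the squared inradius. -/
theorem dist_incenter_sq {A B C : EuclideanSpace ℝ (Fin 2)} {u v w x y z : ℝ}
    (hs : u + v + w ≠ 0) (ha : dist B C = v + w) (hb : dist C A = w + u) (hc : dist A B = u + v)
    (h : x + y + z = 1) :
    dist (bary A B C (v + w) (w + u) (u + v)) (x • A + y • B + z • C) ^ 2 =
      u * v * w / (u + v + w) + ((u * x) ^ 2 + (v * y) ^ 2 + (w * z) ^ 2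
        - 2 * (u * x) * (v * y) - 2 * (v * y) * (w * z) - 2 * (w * z) * (u * x)) := by
  have h2 : v + w + (w + u) + (u + v) = 2 * (u + v + w) := by ring
  have e : bary A B C (v + w) (w + u) (u + v) - (x • A + y • B + z • C) =
      ((v + w) / (2 * (u + v + w)) - x) • A + ((w + u) / (2 * (u + v + w)) - y) • B
        + ((u + v) / (2 * (u + v + w)) - z) • C := by
    rw [bary, h2]
    module
  rw [dist_eq_norm, e, norm_sq_of_weights_sum_zero, ha, hb, hc]
  · obtain rfl : z = 1 - x - y := by linarith
    field_simp
    ring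
  · have : (v + w) / (2 * (u + v + w)) + (w + u) / (2 * (u + v + w))
        + (u + v) / (2 * (u + v + w)) = 1 := by
      field_simp
      ring
    linarith

theorem infDist_incenter_sq {A B C : EuclideanSpace ℝ (Fin 2)} {u v w : ℝ}
    (hu : 0 < u) (hv : 0 < v) (hw : 0 < w)
    (ha : dist B C = v + w) (hb : dist C A = w + u) (hc : dist A B = u + v) :
    Metric.infDist (bary A B C (v + w) (w + u) (u + v))
      (affineSpan ℝ {B, C} : Set (EuclideanSpace ℝ (Fin 2))) ^ 2 = u * v * w / (u + v + w) := by
  have hs : u + v + w ≠ 0 := by positivity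
  set J := bary A B C (v + w) (w + u) (u + v) with hJ
  have key (t : ℝ) : dist J (AffineMap.lineMap B C t) ^ 2 =
      u * v * w / (u + v + w) + ((v + w) * t - v) ^ 2 := by
    have e : (AffineMap.lineMap B C t : EuclideanSpace ℝ (Fin 2)) =
        (0 : ℝ) • A + (1 - t) • B + t • C := by
      rw [AffineMap.lineMap_apply_module]; module
    rw [e, hJ, dist_incenter_sq hs ha hb hc (by ring)]
    ring
  have hD : dist J (AffineMap.lineMap B C (v / (v + w))) ^ 2 = u * v * w / (u + v + w) := by
    rw [key]; field_simp; ring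
  rw [← hD]
  congr 1
  refine le_antisymm (Metric.infDist_le_dist_of_mem (AffineMap.lineMap_mem_affineSpan_pair _ _ _)) ?_
  refine (Metric.le_infDist ⟨B, left_mem_affineSpan_pair ℝ B C⟩).2 fun P hP => ?_
  obtain ⟨t, rfl⟩ := mem_affineSpan_pair_iff_exists_lineMap_eq.1 hP
  refine (sq_le_sq₀ dist_nonneg dist_nonneg).1 ?_
  rw [hD, key]
  nlinarith [sq_nonneg ((v + w) * t - v)]

/-- Rational parametrization of the conic tangent to the three coordinate lines. -/
theorem exists_sq_of_conic {X Y Z : ℝ} (hX : 0 ≤ X) (hY : 0 ≤ Y)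
    (h : X ^ 2 + Y ^ 2 + Z ^ 2 - 2 * X * Y - 2 * Y * Z - 2 * Z * X = 0) :
    ∃ p q r : ℝ, p + q + r = 0 ∧ X = p ^ 2 ∧ Y = q ^ 2 ∧ Z = r ^ 2 := by
  obtain ⟨p, rfl⟩ : ∃ p, X = p ^ 2 := ⟨√X, (Real.sq_sqrt hX).symm⟩
  obtain ⟨q, rfl⟩ : ∃ q, Y = q ^ 2 := ⟨√Y, (Real.sq_sqrt hY).symm⟩
  have : (Z - (p + q) ^ 2) * (Z - (p - q) ^ 2) = 0 := by linear_combination h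
  rcases mul_eq_zero.1 this with h | h
  · exact ⟨p, q, -(p + q), by ring, rfl, rfl, by linear_combination h⟩
  · exact ⟨p, -q, -(p - q), by ring, rfl, by ring, by linear_combination h⟩

theorem nonneg_of_conic {u v w x y z : ℝ} (hu : 0 < u) (hv : 0 < v) (hw : 0 < w)
    (hs : x + y + z = 1)
    (h : (u * x) ^ 2 + (v * y) ^ 2 + (w * z) ^ 2
        - 2 * (u * x) * (v * y) - 2 * (v * y) * (w * z) - 2 * (w * z) * (u * x) = 0) :
    0 ≤ x := by
  by_contra! hx
  have hxy : 0 ≤ 4 * (u * v) * (x * y) := by nlinarith [sq_nonneg (u * x + v * y - w * z)]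
  have hxz : 0 ≤ 4 * (u * w) * (x * z) := by nlinarith [sq_nonneg (u * x + w * z - v * y)]
  have h1 : 0 ≤ x * y := nonneg_of_mul_nonneg_right hxy (by positivity)
  have h2 : 0 ≤ x * z := nonneg_of_mul_nonneg_right hxz (by positivity)
  nlinarith

/-- Parametrization of the incircle in barycentric coordinates. -/
theorem exists_parameters_of_mem_incircle {A B C M : EuclideanSpace ℝ (Fin 2)} {u v w : ℝ}
    (hABC : AffineIndependent ℝ ![A, B, C])
    (hu : 0 < u) (hv : 0 < v) (hw : 0 < w)
    (ha : dist B C = v + w) (hb : dist C A = w + u) (hc : dist A B = u + v)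
    (hM : dist (bary A B C (v + w) (w + u) (u + v)) M =
      Metric.infDist (bary A B C (v + w) (w + u) (u + v))
        (affineSpan ℝ {B, C} : Set (EuclideanSpace ℝ (Fin 2)))) :
    ∃ p q r : ℝ, p + q + r = 0 ∧ p ^ 2 / u + q ^ 2 / v + r ^ 2 / w = 1 ∧
      M = (p ^ 2 / u) • A + (q ^ 2 / v) • B + (r ^ 2 / w) • C := by
  obtain ⟨x, y, z, h1, rfl⟩ := exists_weights_of_affineIndependent hABC M
  have hs : u + v + w ≠ 0 := by positivity
  have hc2 := congrArg (· ^ 2) hM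
  simp only [infDist_incenter_sq hu hv hw ha hb hc, dist_incenter_sq hs ha hb hc h1] at hc2
  have hx := nonneg_of_conic hu hv hw h1 (by linarith)
  have hy : 0 ≤ y := nonneg_of_conic (x := y) (y := z) (z := x) hv hw hu (by linarith) (by linarith)
  obtain ⟨p, q, r, h0, hp, hq, hr⟩ := exists_sq_of_conic (X := u * x) (Y := v * y) (Z := w * z)
    (by positivity) (by positivity) (by linarith)
  have ex : p ^ 2 / u = x := by rw [← hp]; field_simp
  have ey : q ^ 2 / v = y := by rw [← hq]; field_simp
  have ez : r ^ 2 / w = z := by rw [← hr]; field_simp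
  exact ⟨p, q, r, h0, by rw [ex, ey, ez, h1], by rw [ex, ey, ez]⟩

/-- If `A` lies on the line through two points, the points agree in the ratio of their
last two barycentric coordinates. -/
theorem cross_mul_eq_of_mem_line {A B C : EuclideanSpace ℝ (Fin 2)}
    (hABC : AffineIndependent ℝ ![A, B, C]) {x y z x' y' z' : ℝ}
    (h : x + y + z = 1) (h' : x' + y' + z' = 1)
    (hA : A ∈ affineSpan ℝ ({x • A + y • B + z • C, x' • A + y' • B + z' • C} :
      Set (EuclideanSpace ℝ (Fin 2)))) :
    y * z' = y' * z := by
  obtain ⟨t, ht⟩ := mem_affineSpan_pair_iff_exists_lineMap_eq.1 hA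
  rw [AffineMap.lineMap_apply_module] at ht
  obtain ⟨-, hy, hz⟩ := weights_unique_of_affineIndependent hABC
    (x := (1 - t) * x + t * x' - 1) (y := (1 - t) * y + t * y') (z := (1 - t) * z + t * z')
    (by linear_combination (1 - t) * h + t * h')
    (by rw [← sub_eq_zero] at ht; rw [← ht]; module)
  rcases eq_or_ne t 0 with rfl | h0
  · simp only [sub_zero, one_mul, zero_mul, add_zero] at hy hz
    simp [hy, hz]
  · refine mul_left_cancel₀ h0 ?_
    linear_combination y * hz - z * hy

/-- The chord joining two distinct points of the incircle passes through `A` only if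
the parameters of the points are exchanged by the corresponding involution. -/
theorem involution_of_mem_chord {A B C : EuclideanSpace ℝ (Fin 2)}
    (hABC : AffineIndependent ℝ ![A, B, C]) {u v w p q r p' q' r' : ℝ}
    (hv : v ≠ 0) (hw : w ≠ 0)
    (h0 : p + q + r = 0) (h0' : p' + q' + r' = 0)
    (h1 : p ^ 2 / u + q ^ 2 / v + r ^ 2 / w = 1)
    (h1' : p' ^ 2 / u + q' ^ 2 / v + r' ^ 2 / w = 1)
    (hne : (p ^ 2 / u) • A + (q ^ 2 / v) • B + (r ^ 2 / w) • C ≠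
      (p' ^ 2 / u) • A + (q' ^ 2 / v) • B + (r' ^ 2 / w) • C)
    (hA : A ∈ affineSpan ℝ ({(p ^ 2 / u) • A + (q ^ 2 / v) • B + (r ^ 2 / w) • C,
      (p' ^ 2 / u) • A + (q' ^ 2 / v) • B + (r' ^ 2 / w) • C} :
      Set (EuclideanSpace ℝ (Fin 2)))) :
    q * r' = -(q' * r) := by
  have hx := cross_mul_eq_of_mem_line hABC h1 h1' hA
  have hf : (q * r' - q' * r) * (q * r' + q' * r) = 0 := by
    field_simp at hx
    linear_combination hx
  rcases mul_eq_zero.1 hf with h | h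
  · refine absurd ?_ hne
    have hp : p = -q - r := by linarith
    have hp' : p' = -q' - r' := by linarith
    have hqr : q ^ 2 * r' ^ 2 = q' ^ 2 * r ^ 2 := by linear_combination (q * r' + q' * r) * h
    have hpq : p ^ 2 * q' ^ 2 = p' ^ 2 * q ^ 2 := by
      rw [hp, hp']; linear_combination (-2 * q * q' - q' * r - q * r') * h
    have hpr : p ^ 2 * r' ^ 2 = p' ^ 2 * r ^ 2 := by
      rw [hp, hp']; linear_combination (2 * r * r' + q * r' + q' * r) * h
    have ex : p ^ 2 / u = p' ^ 2 / u := by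
      linear_combination (p' ^ 2 / u) * h1 - (p ^ 2 / u) * h1' + hpq / (u * v) + hpr / (u * w)
    have ey : q ^ 2 / v = q' ^ 2 / v := by
      linear_combination (q' ^ 2 / v) * h1 - (q ^ 2 / v) * h1' - hpq / (u * v) + hqr / (v * w)
    have ez : r ^ 2 / w = r' ^ 2 / w := by
      linear_combination (r' ^ 2 / w) * h1 - (r ^ 2 / w) * h1' - hpr / (u * w) - hqr / (v * w)
    rw [ex, ey, ez]
  · linarith

/-- The composition of the three involutions has exactly two fixed points, the roots of
`t ^ 2 = t + 1`. -/
theorem parameters_of_involutions {φ p₁ q₁ r₁ p₂ q₂ r₂ p₃ q₃ r₃ : ℝ} (hφ : φ ^ 2 = φ + 1)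
    (z₁ : p₁ + q₁ + r₁ = 0) (z₂ : p₂ + q₂ + r₂ = 0) (z₃ : p₃ + q₃ + r₃ = 0)
    (n₁ : ¬(p₁ = 0 ∧ q₁ = 0 ∧ r₁ = 0)) (n₂ : ¬(p₂ = 0 ∧ q₂ = 0 ∧ r₂ = 0))
    (n₃ : ¬(p₃ = 0 ∧ q₃ = 0 ∧ r₃ = 0))
    (hA : q₁ * r₂ = -(q₂ * r₁)) (hB : r₂ * p₃ = -(r₃ * p₂)) (hC : p₃ * q₁ = -(p₁ * q₃)) :
    (q₁ = φ * r₁ ∧ q₂ = -φ * r₂ ∧ q₃ = (φ - 2) * r₃) ∨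
      (q₁ = (1 - φ) * r₁ ∧ q₂ = (φ - 1) * r₂ ∧ q₃ = (-φ - 1) * r₃) := by
  have hr₁ : r₁ ≠ 0 := by
    rintro rfl
    have hq₁ : q₁ ≠ 0 := by grind
    have hr₂ : r₂ = 0 := by grind
    have hp₂ : p₂ ≠ 0 := by grind
    have hr₃ : r₃ = 0 := by grind
    have hq₃ : q₃ ≠ 0 := by grind
    have : q₁ * q₃ = 0 := by grind
    grind
  have hr₂ : r₂ ≠ 0 := by grind
  have hr₃ : r₃ ≠ 0 := by grind
  obtain ⟨t, rfl⟩ : ∃ t, q₁ = t * r₁ := ⟨q₁ / r₁, by field_simp⟩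
  obtain rfl : q₂ = -t * r₂ := mul_right_cancel₀ hr₁ (by linear_combination hA)
  obtain rfl : p₂ = (t - 1) * r₂ := by linear_combination z₂
  obtain rfl : p₃ = (1 - t) * r₃ := mul_right_cancel₀ hr₂ (by linear_combination hB)
  obtain rfl : q₃ = (t - 2) * r₃ := by linear_combination z₃
  obtain rfl : p₁ = (-t - 1) * r₁ := by linear_combination z₁
  have ht : (t - φ) * (t - (1 - φ)) = 0 := by
    refine mul_right_cancel₀ (mul_ne_zero hr₁ hr₃) ?_
    linear_combination -hC / 2 - r₁ * r₃ * hφ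
  rcases mul_eq_zero.1 ht with h | h
  · obtain rfl : t = φ := by linarith
    exact .inl ⟨rfl, rfl, rfl⟩
  · obtain rfl : t = 1 - φ := by linarith
    exact .inr ⟨rfl, by ring, by ring⟩

theorem bary_eq_of_sq_proportional (A B C : EuclideanSpace ℝ (Fin 2))
    {u v w p q r x y z k : ℝ} (h : p ^ 2 / u + q ^ 2 / v + r ^ 2 / w = 1)
    (hx : p ^ 2 = k * x) (hy : q ^ 2 = k * y) (hz : r ^ 2 = k * z) :
    (p ^ 2 / u) • A + (q ^ 2 / v) • B + (r ^ 2 / w) • C = bary A B C (x / u) (y / v) (z / w) :=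
  bary_eq_of_proportional A B C h (by rw [hx, mul_div_assoc]) (by rw [hy, mul_div_assoc])
    (by rw [hz, mul_div_assoc])

/-- The Cramer–Castillon problem on the incircle of `ABC` has exactly two solutions:
any pairwise distinct points `M1, M2, M3` on the incircle whose sides pass cyclically
through `A`, `B`, `C` form either the triangle `T1 = (V1, V2, V3)` or the triangle
`T2 = (W1, W2, W3)`. -/
theorem ccp_incircle_exactly_two_solutions
    (A B C : EuclideanSpace ℝ (Fin 2)) (hABC : AffineIndependent ℝ ![A, B, C])
    (a b c s u v w φ : ℝ)
    (ha : a = dist B C) (hb : b = dist C A) (hc : c = dist A B)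
    (hs : s = (a + b + c) / 2)
    (hu : u = s - a) (hv : v = s - b) (hw : w = s - c)
    (hφ : φ = (1 + Real.sqrt 5) / 2)
    (I : EuclideanSpace ℝ (Fin 2)) (hI : I = bary A B C a b c)
    (r : ℝ) (hr : r = Metric.infDist I (affineSpan ℝ {B, C} : Set (EuclideanSpace ℝ (Fin 2))))
    (V1 V2 V3 : EuclideanSpace ℝ (Fin 2))
    (hV1 : V1 = bary A B C (φ ^ 2 / u) (1 / v) ((φ - 1) ^ 2 / w))
    (hV2 : V2 = bary A B C ((φ - 2) ^ 2 / u) (1 / v) ((φ - 1) ^ 2 / w))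
    (hV3 : V3 = bary A B C ((φ - 2) ^ 2 / u) ((2 * φ - 3) ^ 2 / v) ((φ - 1) ^ 2 / w))
    (W1 W2 W3 : EuclideanSpace ℝ (Fin 2))
    (hW1 : W1 = bary A B C (1 / u) (φ ^ 2 / v) ((φ + 1) ^ 2 / w))
    (hW2 : W2 = bary A B C ((2 * φ + 1) ^ 2 / u) (φ ^ 2 / v) ((φ + 1) ^ 2 / w))
    (hW3 : W3 = bary A B C ((2 * φ + 1) ^ 2 / u) ((3 * φ + 2) ^ 2 / v) ((φ + 1) ^ 2 / w))
    (M1 M2 M3 : EuclideanSpace ℝ (Fin 2))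
    (hM12 : M1 ≠ M2) (hM23 : M2 ≠ M3) (hM31 : M3 ≠ M1)
    (hM1 : dist I M1 = r) (hM2 : dist I M2 = r) (hM3 : dist I M3 = r)
    (hA : A ∈ affineSpan ℝ ({M1, M2} : Set (EuclideanSpace ℝ (Fin 2))))
    (hB : B ∈ affineSpan ℝ ({M2, M3} : Set (EuclideanSpace ℝ (Fin 2))))
    (hC : C ∈ affineSpan ℝ ({M3, M1} : Set (EuclideanSpace ℝ (Fin 2)))) :
    (M1 = V1 ∧ M2 = V2 ∧ M3 = V3) ∨ (M1 = W1 ∧ M2 = W2 ∧ M3 = W3) := by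
  have rot : AffineIndependent ℝ ![B, C, A] := by
    rw [affineIndependent_iff_not_collinear_set] at hABC ⊢
    rwa [show ({B, C, A} : Set (EuclideanSpace ℝ (Fin 2))) = {A, B, C} by
      ext; simp; tauto]
  have rot' : AffineIndependent ℝ ![C, A, B] := by
    rw [affineIndependent_iff_not_collinear_set] at hABC ⊢
    rwa [show ({C, A, B} : Set (EuclideanSpace ℝ (Fin 2))) = {A, B, C} by
      ext; simp; tauto]
  have tA := dist_add_dist_gt_of_affineIndependent hABC
  have tB := dist_add_dist_gt_of_affineIndependent rot
  have tC := dist_add_dist_gt_of_affineIndependent rot'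
  rw [dist_comm A C, ← ha, ← hb, ← hc] at tA
  rw [dist_comm B A, ← ha, ← hb, ← hc] at tB
  rw [dist_comm C B, ← ha, ← hb, ← hc] at tC
  have hu0 : 0 < u := by linarith
  have hv0 : 0 < v := by linarith
  have hw0 : 0 < w := by linarith
  have ea : a = v + w := by linarith
  have eb : b = w + u := by linarith
  have ec : c = u + v := by linarith
  rw [ea] at ha
  rw [eb] at hb
  rw [ec] at hc
  rw [ea, eb, ec] at hI
  clear hs hu hv hw tA tB tC ea eb ec
  subst hI hr
  obtain ⟨p₁, q₁, r₁, z₁, n₁, rfl⟩ :=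
    exists_parameters_of_mem_incircle hABC hu0 hv0 hw0 ha.symm hb.symm hc.symm hM1
  obtain ⟨p₂, q₂, r₂, z₂, n₂, rfl⟩ :=
    exists_parameters_of_mem_incircle hABC hu0 hv0 hw0 ha.symm hb.symm hc.symm hM2
  obtain ⟨p₃, q₃, r₃, z₃, n₃, rfl⟩ :=
    exists_parameters_of_mem_incircle hABC hu0 hv0 hw0 ha.symm hb.symm hc.symm hM3
  have cyc (x y z : ℝ) : x • A + y • B + z • C = y • B + z • C + x • A := by abel
  have cyc' (x y z : ℝ) : x • A + y • B + z • C = z • C + x • A + y • B := by abel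
  have iA := involution_of_mem_chord hABC hv0.ne' hw0.ne' z₁ z₂ n₁ n₂ hM12 hA
  have iB : r₂ * p₃ = -(r₃ * p₂) := by
    rw [cyc, cyc] at hB hM23
    exact involution_of_mem_chord rot hw0.ne' hu0.ne' (by linarith) (by linarith)
      (by linarith) (by linarith) hM23 hB
  have iC : p₃ * q₁ = -(p₁ * q₃) := by
    rw [cyc', cyc'] at hC hM31
    exact involution_of_mem_chord rot' hu0.ne' hv0.ne' (by linarith) (by linarith)
      (by linarith) (by linarith) hM31 hC
  have hφ2 : φ ^ 2 = φ + 1 := by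
    have := Real.sq_sqrt (show (0 : ℝ) ≤ 5 by norm_num)
    rw [hφ]; linear_combination this / 4
  have nz {p q r : ℝ} (h : p ^ 2 / u + q ^ 2 / v + r ^ 2 / w = 1) :
      ¬(p = 0 ∧ q = 0 ∧ r = 0) := by
    rintro ⟨rfl, rfl, rfl⟩
    simp at h
  clear hφ
  subst hV1 hV2 hV3 hW1 hW2 hW3
  rcases parameters_of_involutions hφ2 z₁ z₂ z₃ (nz n₁) (nz n₂) (nz n₃) iA iB iC with
    ⟨h₁, h₂, h₃⟩ | ⟨h₁, h₂, h₃⟩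
  · exact .inl
      ⟨bary_eq_of_sq_proportional A B C (k := r₁ ^ 2 * φ ^ 2) n₁ (by grind) (by grind) (by grind),
        bary_eq_of_sq_proportional A B C (k := r₂ ^ 2 * φ ^ 2) n₂ (by grind) (by grind) (by grind),
        bary_eq_of_sq_proportional A B C (k := r₃ ^ 2 * φ ^ 2) n₃ (by grind) (by grind) (by grind)⟩
  · exact .inr
      ⟨bary_eq_of_sq_proportional A B C (k := r₁ ^ 2 * (φ - 2) ^ 2) n₁
          (by grind) (by grind) (by grind),
        bary_eq_of_sq_proportional A B C (k := r₂ ^ 2 * (φ - 2) ^ 2) n₂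
          (by grind) (by grind) (by grind),
        bary_eq_of_sq_proportional A B C (k := r₃ ^ 2 * (φ - 2) ^ 2) n₃
          (by grind) (by grind) (by grind)⟩
end

section
/- The two CCP solution triangles T1 and T2 have the same Brocard angle: the sum of the cotangents of the interior angles of T1 equals the sum of the cotangents of the interior angles of T2, i.e. cot(∠V3 V1 V2) + cot(∠V1 V2 V3) + cot(∠V2 V3 V1) = cot(∠W3 W1 W2) + cot(∠W1 W2 W3) + cot(∠W2 W3 W1), where ∠X Y Z denotes the (unsigned) angle at Y between rays YX and YZ, and cot θ = cos θ / sin θ. -/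
open EuclideanGeometry Real

/-- The cotangent of an angle. -/
noncomputable def cot' (θ : ℝ) : ℝ := Real.cos θ / Real.sin θ

/-- The cross product of two plane vectors. -/
def cross (x y : EuclideanSpace ℝ (Fin 2)) : ℝ := x 0 * y 1 - x 1 * y 0

theorem inner_eq_coords (x y : EuclideanSpace ℝ (Fin 2)) :
    inner ℝ x y = x 0 * y 0 + x 1 * y 1 := by
  simp [PiLp.inner_apply, Fin.sum_univ_two, mul_comm]

theorem cot'_angle (x y : EuclideanSpace ℝ (Fin 2)) :
    cot' (InnerProductGeometry.angle x y) = inner ℝ x y / |cross x y| := by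
  have h_sin := InnerProductGeometry.sin_angle_mul_norm_mul_norm x y
  have h_cos := InnerProductGeometry.cos_angle_mul_norm_mul_norm x y
  have h_cross : inner ℝ x x * inner ℝ y y - inner ℝ x y * inner ℝ x y = cross x y ^ 2 := by
    simp only [inner_eq_coords, cross]; ring
  rw [h_cross, Real.sqrt_sq_eq_abs] at h_sin
  rw [← h_cos, ← h_sin, cot']
  by_cases h : ‖x‖ * ‖y‖ = 0
  · have : x = 0 ∨ y = 0 := by simpa using h
    rcases this with rfl | rfl <;> simp
  · rw [mul_div_mul_right _ _ h]

/-- The sum of the cotangents of the angles of a triangle, from two sides issuing from `Q`. -/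
theorem sum_cot'_angles (P Q R : EuclideanSpace ℝ (Fin 2)) :
    cot' (∠ R P Q) + cot' (∠ P Q R) + cot' (∠ Q R P) =
      (inner ℝ (P - Q) (P - Q) + inner ℝ (R - Q) (R - Q) - inner ℝ (P - Q) (R - Q)) /
        |cross (P - Q) (R - Q)| := by
  simp only [EuclideanGeometry.angle, cot'_angle, vsub_eq_sub]
  have h₁ : cross (R - P) (Q - P) = cross (P - Q) (R - Q) := by simp [cross]; ring
  have h₂ : cross (Q - R) (P - R) = cross (P - Q) (R - Q) := by simp [cross]; ring
  rw [h₁, h₂, ← add_div, ← add_div]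
  congr 1
  simp only [inner_eq_coords, PiLp.sub_apply]
  ring

/-- The difference of two points whose barycentric coordinates differ in the first entry only. -/
theorem bary_sub_bary_first (A B C : EuclideanSpace ℝ (Fin 2)) {u v w p₁ p₂ q r : ℝ}
    (hu : 0 < u) (hv : 0 < v) (hw : 0 < w)
    (h₁ : p₁ * v * w + q * u * w + r * u * v ≠ 0)
    (h₂ : p₂ * v * w + q * u * w + r * u * v ≠ 0) :
    bary A B C (p₁ / u) (q / v) (r / w) - bary A B C (p₂ / u) (q / v) (r / w) =
      (u * v * w * (p₁ - p₂) / ((p₁ * v * w + q * u * w + r * u * v) *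
        (p₂ * v * w + q * u * w + r * u * v))) •
        (-(q * w) • (B - A) + -(r * v) • (C - A)) := by
  have h (p : ℝ) : p / u + q / v + r / w =
      (p * v * w + q * u * w + r * u * v) / (u * v * w) := by
    field_simp
  ext i
  simp only [bary, h, PiLp.sub_apply, PiLp.add_apply, PiLp.smul_apply, smul_eq_mul]
  generalize hs₁ : p₁ * v * w + q * u * w + r * u * v = s₁ at *
  generalize hs₂ : p₂ * v * w + q * u * w + r * u * v = s₂ at *
  field_simp
  rw [← hs₁, ← hs₂]
  ring

/-- The difference of two points whose barycentric coordinates differ in the second entry only. -/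
theorem bary_sub_bary_second (A B C : EuclideanSpace ℝ (Fin 2)) {u v w p q₁ q₂ r : ℝ}
    (hu : 0 < u) (hv : 0 < v) (hw : 0 < w)
    (h₁ : p * v * w + q₁ * u * w + r * u * v ≠ 0)
    (h₂ : p * v * w + q₂ * u * w + r * u * v ≠ 0) :
    bary A B C (p / u) (q₁ / v) (r / w) - bary A B C (p / u) (q₂ / v) (r / w) =
      (u * v * w * (q₁ - q₂) / ((p * v * w + q₁ * u * w + r * u * v) *
        (p * v * w + q₂ * u * w + r * u * v))) •
        ((p * w + r * u) • (B - A) + -(r * u) • (C - A)) := by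
  have h (q : ℝ) : p / u + q / v + r / w =
      (p * v * w + q * u * w + r * u * v) / (u * v * w) := by
    field_simp
  ext i
  simp only [bary, h, PiLp.sub_apply, PiLp.add_apply, PiLp.smul_apply, smul_eq_mul]
  generalize hs₁ : p * v * w + q₁ * u * w + r * u * v = s₁ at *
  generalize hs₂ : p * v * w + q₂ * u * w + r * u * v = s₂ at *
  field_simp
  rw [← hs₁, ← hs₂]
  ring

theorem mul_add_mul_add_mul_pos {u v w p q r : ℝ} (hu : 0 < u) (hv : 0 < v) (hw : 0 < w)
    (hp : 0 < p) (hq : 0 < q) (hr : 0 < r) : 0 < p * v * w + q * u * w + r * u * v := by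
  positivity

/-- If `u, v, w` are the tangent lengths of `ABC`, the triangle with vertices
`[p₁/u : q/v : r/w]`, `[p₂/u : q/v : r/w]`, `[p₂/u : q₃/v : r/w]` has cotangent sum
`2 (uv + vw + wu)` over twice the area of `ABC`, provided the coordinates satisfy the
polynomial identity `key`. -/
theorem sum_cot'_angles_bary (A B C : EuclideanSpace ℝ (Fin 2)) {u v w p₁ p₂ q q₃ r : ℝ}
    (hu : 0 < u) (hv : 0 < v) (hw : 0 < w)
    (ha : v + w = dist B C) (hb : u + w = dist C A) (hc : u + v = dist A B)
    (hp₁ : 0 < p₁) (hp₂ : 0 < p₂) (hq : 0 < q) (hq₃ : 0 < q₃) (hr : 0 < r)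
    (hpq : 0 < (p₁ - p₂) * (q - q₃))
    {s₁ s₂ s₃ xx yy xy : ℝ}
    (hs₁ : s₁ = p₁ * v * w + q * u * w + r * u * v)
    (hs₂ : s₂ = p₂ * v * w + q * u * w + r * u * v)
    (hs₃ : s₃ = p₂ * v * w + q₃ * u * w + r * u * v)
    (hxx : xx = (q * w) ^ 2 * (u + v) ^ 2 + (r * v) ^ 2 * (u + w) ^ 2 +
      2 * (q * w) * (r * v) * (u ^ 2 + u * v + u * w - v * w))
    (hyy : yy = (p₂ * w + r * u) ^ 2 * (u + v) ^ 2 + (r * u) ^ 2 * (u + w) ^ 2 -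
      2 * (p₂ * w + r * u) * (r * u) * (u ^ 2 + u * v + u * w - v * w))
    (hxy : xy = -(q * w) * (p₂ * w + r * u) * (u + v) ^ 2 + (r * v) * (r * u) * (u + w) ^ 2 +
      ((q * w) * (r * u) - (r * v) * (p₂ * w + r * u)) * (u ^ 2 + u * v + u * w - v * w))
    (key : (p₁ - p₂) ^ 2 * s₃ ^ 2 * xx + (q₃ - q) ^ 2 * s₁ ^ 2 * yy -
      (p₁ - p₂) * (q₃ - q) * s₁ * s₃ * xy =
        2 * (u * v + v * w + w * u) * ((p₁ - p₂) * (q - q₃) * r * s₁ * s₂ * s₃)) :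
    let V₁ := bary A B C (p₁ / u) (q / v) (r / w)
    let V₂ := bary A B C (p₂ / u) (q / v) (r / w)
    let V₃ := bary A B C (p₂ / u) (q₃ / v) (r / w)
    cot' (∠ V₃ V₁ V₂) + cot' (∠ V₁ V₂ V₃) + cot' (∠ V₂ V₃ V₁) =
      2 * (u * v + v * w + w * u) / |cross (B - A) (C - A)| := by
  have hs₁' : 0 < s₁ := hs₁ ▸ mul_add_mul_add_mul_pos hu hv hw hp₁ hq hr
  have hs₂' : 0 < s₂ := hs₂ ▸ mul_add_mul_add_mul_pos hu hv hw hp₂ hq hr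
  have hs₃' : 0 < s₃ := hs₃ ▸ mul_add_mul_add_mul_pos hu hv hw hp₂ hq₃ hr
  have hEE : inner ℝ (B - A) (B - A) = (u + v) ^ 2 := by
    rw [hc, dist_comm, dist_eq_norm, real_inner_self_eq_norm_sq]
  have hFF : inner ℝ (C - A) (C - A) = (u + w) ^ 2 := by
    rw [hb, dist_eq_norm, real_inner_self_eq_norm_sq]
  have hEF : inner ℝ (B - A) (C - A) = u ^ 2 + u * v + u * w - v * w := by
    have := norm_sub_sq_real (B - A) (C - A)
    rw [sub_sub_sub_cancel_right, ← dist_eq_norm, ← ha, ← dist_eq_norm, ← dist_eq_norm,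
      dist_comm B A, ← hc, ← hb] at this
    linarith
  intro V₁ V₂ V₃
  rw [sum_cot'_angles, bary_sub_bary_first A B C hu hv hw (hs₁ ▸ hs₁'.ne') (hs₂ ▸ hs₂'.ne'),
    bary_sub_bary_second A B C hu hv hw (hs₃ ▸ hs₃'.ne') (hs₂ ▸ hs₂'.ne'), ← hs₁, ← hs₂, ← hs₃]
  set E := B - A
  set F := C - A
  have hFE : inner ℝ F E = u ^ 2 + u * v + u * w - v * w := by rw [real_inner_comm, hEF]
  set X := -(q * w) • E + -(r * v) • F with hX
  set Y := (p₂ * w + r * u) • E + -(r * u) • F with hY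
  have hXX : inner ℝ X X = xx := by
    simp only [hX, inner_add_left, inner_add_right, real_inner_smul_left, real_inner_smul_right,
      hEE, hFF, hEF, hFE, hxx]
    ring
  have hYY : inner ℝ Y Y = yy := by
    simp only [hY, inner_add_left, inner_add_right, real_inner_smul_left, real_inner_smul_right,
      hEE, hFF, hEF, hFE, hyy]
    ring
  have hXY : inner ℝ X Y = xy := by
    simp only [hX, hY, inner_add_left, inner_add_right, real_inner_smul_left,
      real_inner_smul_right, hEE, hFF, hEF, hFE, hxy]
    ring
  have h_cross (k l : ℝ) : cross (k • X) (l • Y) = k * l * (r * s₂) * cross E F := by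
    simp only [cross, hX, hY, hs₂, PiLp.add_apply, PiLp.smul_apply, smul_eq_mul]
    ring
  rw [h_cross]
  simp only [real_inner_smul_left, real_inner_smul_right, hXX, hYY, hXY]
  set k := u * v * w * (p₁ - p₂) / (s₁ * s₂) with hk
  set l := u * v * w * (q₃ - q) / (s₃ * s₂) with hl
  have hkl : k * l * (r * s₂) =
      -((u * v * w) ^ 2 * ((p₁ - p₂) * (q - q₃)) * r / (s₁ * s₂ * s₃)) := by
    rw [hk, hl]
    field_simp
    ring
  have hpos : 0 < (u * v * w) ^ 2 * ((p₁ - p₂) * (q - q₃)) * r / (s₁ * s₂ * s₃) := by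
    positivity
  have hnum : k * (k * xx) + l * (l * yy) - l * (k * xy) =
      (u * v * w) ^ 2 * ((p₁ - p₂) * (q - q₃)) * r / (s₁ * s₂ * s₃) *
        (2 * (u * v + v * w + w * u)) := by
    have : k * (k * xx) + l * (l * yy) - l * (k * xy) = (u * v * w) ^ 2 / (s₁ * s₂ * s₃) ^ 2 *
        ((p₁ - p₂) ^ 2 * s₃ ^ 2 * xx + (q₃ - q) ^ 2 * s₁ ^ 2 * yy -
          (p₁ - p₂) * (q₃ - q) * s₁ * s₃ * xy) := by
      rw [hk, hl]
      field_simp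
    rw [this, key]
    field_simp
  rw [hkl, abs_mul, abs_neg, abs_of_pos hpos]
  rw [hnum, mul_div_mul_left _ _ hpos.ne']

/-- The two CCP solution triangles `T1` and `T2` have the same Brocard angle: the sums of
the cotangents of their interior angles agree. -/
theorem ccp_solutions_same_brocard_angle
    (A B C : EuclideanSpace ℝ (Fin 2)) (hABC : AffineIndependent ℝ ![A, B, C])
    (a b c s u v w φ : ℝ)
    (ha : a = dist B C) (hb : b = dist C A) (hc : c = dist A B)
    (hs : s = (a + b + c) / 2)
    (hu : u = s - a) (hv : v = s - b) (hw : w = s - c)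
    (hφ : φ = (1 + Real.sqrt 5) / 2)
    (V1 V2 V3 : EuclideanSpace ℝ (Fin 2))
    (hV1 : V1 = bary A B C (φ ^ 2 / u) (1 / v) ((φ - 1) ^ 2 / w))
    (hV2 : V2 = bary A B C ((φ - 2) ^ 2 / u) (1 / v) ((φ - 1) ^ 2 / w))
    (hV3 : V3 = bary A B C ((φ - 2) ^ 2 / u) ((2 * φ - 3) ^ 2 / v) ((φ - 1) ^ 2 / w))
    (W1 W2 W3 : EuclideanSpace ℝ (Fin 2))
    (hW1 : W1 = bary A B C (1 / u) (φ ^ 2 / v) ((φ + 1) ^ 2 / w))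
    (hW2 : W2 = bary A B C ((2 * φ + 1) ^ 2 / u) (φ ^ 2 / v) ((φ + 1) ^ 2 / w))
    (hW3 : W3 = bary A B C ((2 * φ + 1) ^ 2 / u) ((3 * φ + 2) ^ 2 / v) ((φ + 1) ^ 2 / w)) :
    cot' (∠ V3 V1 V2) + cot' (∠ V1 V2 V3) + cot' (∠ V2 V3 V1) =
      cot' (∠ W3 W1 W2) + cot' (∠ W1 W2 W3) + cot' (∠ W2 W3 W1) := by
  have h_col : ¬ Collinear ℝ {A, B, C} := affineIndependent_iff_not_collinear_set.mp hABC
  have hu' : 0 < u := by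
    have : dist B C < dist B A + dist A C := dist_lt_dist_add_dist_iff.mpr fun h ↦
      h_col (by simpa only [Set.insert_comm] using h.collinear)
    rw [dist_comm B A, dist_comm A C] at this
    linarith
  have hv' : 0 < v := by
    have : dist C A < dist C B + dist B A := dist_lt_dist_add_dist_iff.mpr fun h ↦
      h_col (by
        have := h.collinear
        rwa [Set.pair_comm B A, Set.insert_comm C A, Set.pair_comm C B] at this)
    rw [dist_comm C B, dist_comm B A] at this
    linarith
  have hw' : 0 < w := by
    have : dist A B < dist A C + dist C B := dist_lt_dist_add_dist_iff.mpr fun h ↦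
      h_col (by simpa only [Set.pair_comm] using h.collinear)
    rw [dist_comm A C, dist_comm C B] at this
    linarith
  have ha' : v + w = dist B C := by linarith
  have hb' : u + w = dist C A := by linarith
  have hc' : u + v = dist A B := by linarith
  have hφ2 : φ ^ 2 = φ + 1 := by
    rw [hφ]
    linear_combination Real.sq_sqrt (show (0 : ℝ) ≤ 5 by norm_num) / 4
  have hφl : 1.61 < φ := by
    have : (2.22 : ℝ) < √5 := Real.lt_sqrt_of_sq_lt (by norm_num)
    rw [hφ]; linarith
  have hφu : φ < 1.62 := by
    have : √5 < 2.24 := (Real.sqrt_lt' (by norm_num)).mpr (by norm_num)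
    rw [hφ]; linarith
  have e₁ : (φ - 1) ^ 2 = 2 - φ := by linear_combination hφ2
  have e₂ : (φ - 2) ^ 2 = 5 - 3 * φ := by linear_combination hφ2
  have e₃ : (2 * φ - 3) ^ 2 = 13 - 8 * φ := by linear_combination 4 * hφ2
  have e₄ : (φ + 1) ^ 2 = 3 * φ + 2 := by linear_combination hφ2
  have e₅ : (2 * φ + 1) ^ 2 = 8 * φ + 5 := by linear_combination 4 * hφ2
  have e₆ : (3 * φ + 2) ^ 2 = 21 * φ + 13 := by linear_combination 9 * hφ2
  rw [e₁, hφ2] at hV1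
  rw [e₁, e₂] at hV2
  rw [e₁, e₂, e₃] at hV3
  rw [e₄, hφ2] at hW1
  rw [e₄, e₅, hφ2] at hW2
  rw [e₄, e₅, e₆] at hW3
  subst hV1 hV2 hV3 hW1 hW2 hW3
  have h3 : φ ^ 3 = 2 * φ + 1 := by linear_combination (φ + 1) * hφ2
  have h4 : φ ^ 4 = 3 * φ + 2 := by linear_combination φ * h3 + 2 * hφ2
  have h5 : φ ^ 5 = 5 * φ + 3 := by linear_combination φ * h4 + 3 * hφ2
  have h6 : φ ^ 6 = 8 * φ + 5 := by linear_combination φ * h5 + 5 * hφ2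
  rw [sum_cot'_angles_bary A B C hu' hv' hw' ha' hb' hc' (by linarith) (by linarith)
      one_pos (by linarith) (by linarith)
      (mul_pos (by linarith) (by linarith)) rfl rfl rfl rfl rfl rfl
      (by ring_nf; simp only [hφ2, h3, h4, h5, h6]; ring),
    sum_cot'_angles_bary A B C hu' hv' hw' ha' hb' hc' one_pos (by linarith)
      (by linarith) (by linarith) (by linarith)
      (mul_pos_of_neg_of_neg (by linarith) (by linarith)) rfl rfl rfl rfl rfl rfl
      (by ring_nf; simp only [hφ2, h3, h4, h5, h6]; ring)]
end

section
/- The triangle T1exc with vertices P1, P2, P3 is a solution of the Cramer–Castillon problem for the triangle ABC and its A-excircle: P1, P2 and P3 all lie on the A-excircle (dist(E_A,P1) = dist(E_A,P2) = dist(E_A,P3) = r_A), and the sides pass cyclically through the vertices of ABC, namely C lies on the line through P1 and P2, A lies on the line through P2 and P3, and B lies on the line through P3 and P1. -/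
open EuclideanGeometry

section Barycentric

variable {A B C : EuclideanSpace ℝ (Fin 2)}

/-- Squared distance between two points given by normalised barycentric coordinates, in terms of
the side lengths. -/
lemma dist_bary_bary_sq {x y z x' y' z' : ℝ} (h : x + y + z ≠ 0) (h' : x' + y' + z' ≠ 0) :
    dist (bary A B C x y z) (bary A B C x' y' z') ^ 2 =
      (y / (x + y + z) - y' / (x' + y' + z')) ^ 2 * dist A B ^ 2 +
      (z / (x + y + z) - z' / (x' + y' + z')) ^ 2 * dist C A ^ 2 +
      (y / (x + y + z) - y' / (x' + y' + z')) * (z / (x + y + z) - z' / (x' + y' + z')) *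
        (dist C A ^ 2 + dist A B ^ 2 - dist B C ^ 2) := by
  have hd : bary A B C x y z - bary A B C x' y' z' =
      (y / (x + y + z) - y' / (x' + y' + z')) • (B - A) +
      (z / (x + y + z) - z' / (x' + y' + z')) • (C - A) := by
    unfold bary
    match_scalars <;> field_simp
    ring
  have hBC : dist B C ^ 2 =
      ‖B - A‖ ^ 2 - 2 * inner ℝ (B - A) (C - A) + ‖C - A‖ ^ 2 := by
    rw [dist_eq_norm, ← norm_sub_sq_real, sub_sub_sub_cancel_right]
  rw [hBC, dist_eq_norm, hd, dist_comm A B, dist_eq_norm, dist_eq_norm, norm_add_sq_real,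
    norm_smul, norm_smul, inner_smul_left, inner_smul_right, mul_pow, mul_pow, Real.norm_eq_abs,
    Real.norm_eq_abs, sq_abs, sq_abs]
  simp only [conj_trivial]
  ring

lemma lineMap_eq_bary (t : ℝ) : AffineMap.lineMap B C t = bary A B C 0 (1 - t) t := by
  rw [AffineMap.lineMap_apply_module]
  simp [bary]

lemma mem_affineSpan_pair_of_smul_add_smul_eq {P Q R : EuclideanSpace ℝ (Fin 2)} {k l : ℝ}
    (hkl : k + l ≠ 0) (h : k • P + l • Q = (k + l) • R) : R ∈ affineSpan ℝ {P, Q} := by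
  have hR : R = AffineMap.lineMap P Q (l / (k + l)) := by
    rw [AffineMap.lineMap_apply_module, ← inv_smul_smul₀ hkl R, ← h]
    match_scalars <;> field_simp
    ring
  rw [hR]
  exact AffineMap.lineMap_mem_affineSpan_pair _ _ _

lemma sum_smul_bary {x y z : ℝ} (h : x + y + z ≠ 0) :
    (x + y + z) • bary A B C x y z = x • A + y • B + z • C :=
  smul_inv_smul₀ h _

/-- A point `R` lies on the line through two points given in barycentric coordinates as soon as some
combination of their unnormalised coordinates represents `R`. -/
lemma mem_affineSpan_bary_pair {R : EuclideanSpace ℝ (Fin 2)} {x y z x' y' z' k l m : ℝ}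
    (h : x + y + z ≠ 0) (h' : x' + y' + z' ≠ 0) (hm : m ≠ 0)
    (hsum : k * (x + y + z) + l * (x' + y' + z') = m)
    (hR : (k * x + l * x') • A + (k * y + l * y') • B + (k * z + l * z') • C = m • R) :
    R ∈ affineSpan ℝ {bary A B C x y z, bary A B C x' y' z'} := by
  refine mem_affineSpan_pair_of_smul_add_smul_eq
    (k := k * (x + y + z)) (l := l * (x' + y' + z')) (hsum ▸ hm) ?_
  rw [mul_smul, mul_smul, sum_smul_bary h, sum_smul_bary h', hsum, ← hR]
  module

lemma AffineIndependent.dist_lt_dist_add_dist (h : AffineIndependent ℝ ![A, B, C]) :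
    dist A C < dist A B + dist B C := by
  refine lt_of_le_of_ne (dist_triangle A B C) fun he => ?_
  exact affineIndependent_iff_not_collinear_set.1 h (dist_add_dist_eq_iff.1 he.symm).collinear

variable {u v w : ℝ}

lemma excircle_coord_sum_pos (hu : 0 < u) (hv : 0 < v) (hw : 0 < w) {x y z : ℝ}
    (hxyz : x = y + z) (hx : x ≠ 0) :
    0 < -(v * w) * x ^ 2 + (u + v + w) * v * y ^ 2 + (u + v + w) * w * z ^ 2 := by
  have key : -(v * w) * x ^ 2 + (u + v + w) * v * y ^ 2 + (u + v + w) * w * z ^ 2 =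
      u * (v * y ^ 2 + w * z ^ 2) + (v * y - w * z) ^ 2 := by
    subst hxyz; ring
  have hyz : 0 < v * y ^ 2 + w * z ^ 2 := by
    rcases eq_or_ne y 0 with rfl | hy
    · have : z ≠ 0 := by simpa [hxyz] using hx
      positivity
    · positivity
  rw [key]
  positivity

/-- The parametrised points `[-vw x² : sv y² : sw z²]`, `x = y + z`, lie on the `A`-excircle, where
`u`, `v`, `w` are the tangent lengths `s - a`, `s - b`, `s - c`. -/
lemma dist_excenter_sq (ha : dist B C = v + w) (hb : dist C A = u + w) (hc : dist A B = u + v)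
    (hu : 0 < u) {x y z : ℝ} (hxyz : x = y + z)
    (hσ : -(v * w) * x ^ 2 + (u + v + w) * v * y ^ 2 + (u + v + w) * w * z ^ 2 ≠ 0) :
    dist (bary A B C (-(v + w)) (u + w) (u + v))
      (bary A B C (-(v * w) * x ^ 2) ((u + v + w) * v * y ^ 2) ((u + v + w) * w * z ^ 2)) ^ 2 =
      (u + v + w) * v * w / u := by
  have h2 : -(v + w) + (u + w) + (u + v) = 2 * u := by ring
  rw [dist_bary_bary_sq (by rw [h2]; positivity) hσ, ha, hb, hc, h2]
  obtain ⟨σ, hσ'⟩ : ∃ σ, σ = -(v * w) * x ^ 2 + (u + v + w) * v * y ^ 2 +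
      (u + v + w) * w * z ^ 2 := ⟨_, rfl⟩
  rw [← hσ'] at hσ ⊢
  field_simp
  rw [hσ', hxyz]
  ring

lemma dist_excenter_lineMap_sq (ha : dist B C = v + w) (hb : dist C A = u + w)
    (hc : dist A B = u + v) (hu : 0 < u) (t : ℝ) :
    dist (bary A B C (-(v + w)) (u + w) (u + v)) (AffineMap.lineMap B C t) ^ 2 =
      (u + v + w) * v * w / u + (t * (v + w) - w) ^ 2 := by
  have h2 : -(v + w) + (u + w) + (u + v) = 2 * u := by ring
  have h1 : 0 + (1 - t) + t = 1 := by ring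
  rw [lineMap_eq_bary (A := A), dist_bary_bary_sq (by rw [h2]; positivity) (by simp), ha, hb, hc,
    h2, h1]
  field_simp
  ring

lemma infDist_excenter (ha : dist B C = v + w) (hb : dist C A = u + w) (hc : dist A B = u + v)
    (hu : 0 < u) (hv : 0 < v) (hw : 0 < w) :
    Metric.infDist (bary A B C (-(v + w)) (u + w) (u + v))
      (affineSpan ℝ {B, C} : Set (EuclideanSpace ℝ (Fin 2))) =
      √((u + v + w) * v * w / u) := by
  apply le_antisymm
  · refine (Metric.infDist_le_dist_of_mem
      (AffineMap.lineMap_mem_affineSpan_pair (w / (v + w)) B C)).trans ?_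
    apply Real.le_sqrt_of_sq_le
    rw [dist_excenter_lineMap_sq ha hb hc hu, div_mul_cancel₀ _ (by positivity)]
    simp
  · rw [Metric.le_infDist ⟨B, left_mem_affineSpan_pair ℝ B C⟩]
    intro Q hQ
    obtain ⟨t, rfl⟩ := mem_affineSpan_pair_iff_exists_lineMap_eq.1 hQ
    apply Real.sqrt_le_iff.2 ⟨dist_nonneg, ?_⟩
    rw [dist_excenter_lineMap_sq ha hb hc hu]
    exact le_add_of_nonneg_right (sq_nonneg _)

end Barycentric

/-- The triangle `T1exc = (P1, P2, P3)` is a solution of the Cramer–Castillon problem for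
the triangle `ABC` and its A-excircle: its vertices lie on the A-excircle and its sides
pass cyclically through `C`, `A`, `B`. -/
theorem ccp_a_excircle_first_solution
    (A B C : EuclideanSpace ℝ (Fin 2)) (hABC : AffineIndependent ℝ ![A, B, C])
    (a b c s φ : ℝ)
    (ha : a = dist B C) (hb : b = dist C A) (hc : c = dist A B)
    (hs : s = (a + b + c) / 2)
    (hφ : φ = (1 + Real.sqrt 5) / 2)
    (EA : EuclideanSpace ℝ (Fin 2)) (hEA : EA = bary A B C (-a) b c)
    (rA : ℝ)
    (hrA : rA = Metric.infDist EA (affineSpan ℝ {B, C} : Set (EuclideanSpace ℝ (Fin 2))))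
    (P1 P2 P3 : EuclideanSpace ℝ (Fin 2))
    (hP1 : P1 = bary A B C ((c - s) * (s - b) * (φ - 1) ^ 2) (s * (s - b))
      (s * (s - c) * (φ - 2) ^ 2))
    (hP2 : P2 = bary A B C ((c - s) * (s - b) * (φ - 2) ^ 2) (s * (s - b) * (φ - 1) ^ 2)
      (s * (s - c)))
    (hP3 : P3 = bary A B C ((b - s) * (s - c)) (s * (s - b) * (φ - 2) ^ 2)
      (s * (s - c) * (φ - 1) ^ 2)) :
    dist EA P1 = rA ∧ dist EA P2 = rA ∧ dist EA P3 = rA ∧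
    C ∈ affineSpan ℝ ({P1, P2} : Set (EuclideanSpace ℝ (Fin 2))) ∧
    A ∈ affineSpan ℝ ({P2, P3} : Set (EuclideanSpace ℝ (Fin 2))) ∧
    B ∈ affineSpan ℝ ({P3, P1} : Set (EuclideanSpace ℝ (Fin 2))) := by
  obtain ⟨u, hu⟩ : ∃ u, u = s - a := ⟨_, rfl⟩
  obtain ⟨v, hv⟩ : ∃ v, v = s - b := ⟨_, rfl⟩
  obtain ⟨w, hw⟩ : ∃ w, w = s - c := ⟨_, rfl⟩
  have hu0 : 0 < u := by
    have h := (hABC.comm_left).dist_lt_dist_add_dist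
    rw [dist_comm B A, dist_comm A C] at h
    linarith
  have hv0 : 0 < v := by
    have h := hABC.dist_lt_dist_add_dist
    rw [dist_comm A C] at h
    linarith
  have hw0 : 0 < w := by
    have h := (hABC.comm_right).dist_lt_dist_add_dist
    rw [dist_comm A C, dist_comm C B] at h
    linarith
  have hs' : s = u + v + w := by linarith
  have ha' : a = v + w := by linarith
  have hb' : b = u + w := by linarith
  have hc' : c = u + v := by linarith
  have hφ2 : φ ^ 2 = φ + 1 := by rw [hφ]; exact Real.goldenRatio_sq
  have hφ1 : 1 < φ := by rw [hφ]; exact Real.one_lt_goldenRatio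
  have hφ2' : φ < 2 := by rw [hφ]; exact Real.goldenRatio_lt_two
  have e1 : P1 = bary A B C (-(v * w) * (φ - 1) ^ 2) ((u + v + w) * v * 1 ^ 2)
      ((u + v + w) * w * (φ - 2) ^ 2) := by
    rw [hP1, hs', hb', hc']; congr 1 <;> ring
  have e2 : P2 = bary A B C (-(v * w) * (φ - 2) ^ 2) ((u + v + w) * v * (φ - 1) ^ 2)
      ((u + v + w) * w * (-1) ^ 2) := by
    rw [hP2, hs', hb', hc']; congr 1 <;> ring
  have e3 : P3 = bary A B C (-(v * w) * 1 ^ 2) ((u + v + w) * v * (2 - φ) ^ 2)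
      ((u + v + w) * w * (φ - 1) ^ 2) := by
    rw [hP3, hs', hb', hc']; congr 1 <;> ring
  have σ1 := (excircle_coord_sum_pos hu0 hv0 hw0
    (show φ - 1 = 1 + (φ - 2) by ring) (by linarith)).ne'
  have σ2 := (excircle_coord_sum_pos hu0 hv0 hw0
    (show φ - 2 = (φ - 1) + (-1) by ring) (by linarith)).ne'
  have σ3 := (excircle_coord_sum_pos hu0 hv0 hw0
    (show (1 : ℝ) = (2 - φ) + (φ - 1) by ring) one_ne_zero).ne'
  have hBC : dist B C = v + w := ha.symm.trans ha'
  have hCA : dist C A = u + w := hb.symm.trans hb'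
  have hAB : dist A B = u + v := hc.symm.trans hc'
  have hr := infDist_excenter hBC hCA hAB hu0 hv0 hw0
  rw [ha', hb', hc'] at hEA
  rw [← hEA, ← hrA] at hr
  have hsq : (φ - 1) ^ 2 = 2 - φ := by linear_combination hφ2
  have hsq' : (φ - 2) ^ 2 = (2 - φ) ^ 2 := by ring
  have hcube : (2 - φ) ^ 3 < 1 := pow_lt_one₀ (by linarith) (by linarith) (by norm_num)
  refine ⟨?_, ?_, ?_, ?_, ?_, ?_⟩
  · rw [hr, hEA, e1, ← dist_excenter_sq hBC hCA hAB hu0 (by ring) σ1, Real.sqrt_sq dist_nonneg]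
  · rw [hr, hEA, e2, ← dist_excenter_sq hBC hCA hAB hu0 (by ring) σ2, Real.sqrt_sq dist_nonneg]
  · rw [hr, hEA, e3, ← dist_excenter_sq hBC hCA hAB hu0 (by ring) σ3, Real.sqrt_sq dist_nonneg]
  · rw [e1, e2]
    refine mem_affineSpan_bary_pair (k := 2 - φ) (l := -1)
      (m := (u + v + w) * w * ((2 - φ) ^ 3 - 1)) σ1 σ2 ?_ ?_ ?_
    · exact mul_ne_zero (by positivity) (by linarith)
    · rw [hsq]; ring
    · rw [hsq]; module
  · rw [e2, e3]
    refine mem_affineSpan_bary_pair (k := 2 - φ) (l := -1)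
      (m := v * w * (1 - (2 - φ) ^ 3)) σ2 σ3 ?_ ?_ ?_
    · exact mul_ne_zero (by positivity) (by linarith)
    · rw [hsq]; ring
    · rw [hsq]; module
  · rw [e3, e1]
    refine mem_affineSpan_bary_pair (k := 2 - φ) (l := -1)
      (m := (u + v + w) * v * ((2 - φ) ^ 3 - 1)) σ3 σ1 ?_ ?_ ?_
    · exact mul_ne_zero (by positivity) (by linarith)
    · rw [hsq]; ring
    · rw [hsq]; module
end
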